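/- arXiv:1410.6228 — 4 statements merged into one kernel-verified Lean document; each statement's English description precedes it below -/
import Mathlib

section
/- Discrete charge conservation for symplectic stochastic Runge–Kutta semi-discretizations (Proposition 3.3, conservation part, pathwise form): Let s ≥ 1 and suppose the Runge–Kutta coefficients (a_{ij}^{(0)}), (a_{ij}^{(1)}), (b_i^{(0)}), (b_i^{(1)}) satisfy the symplectic conditions. Let Δt, ΔW, ε ∈ ℝ, let φⁿ, φ^{n+1} : [−L,L] → ℂ be continuous, let φ_1,…,φ_s : [−L,L] → ℂ be twice continuously differentiable and satisfy Dirichlet boundary conditions, and let Ψ'_1,…,Ψ'_s : [−L,L] → ℝ be continuous. Set h_i := φ_i'' + Ψ'_i·φ_i and h̃_i := ε·φ_i. If for every x ∈ [−L,L] and every i = 1,…,s one has φ_i(x) = φⁿ(x) + 𝐢 Δt Σ_{j=1}^s a_{ij}^{(0)} h_j(x) − 𝐢 ΔW Σ_{j=1}^s a_{ij}^{(1)} h̃_j(x) and φ^{n+1}(x) = φⁿ(x) + 𝐢 Δt Σ_{i=1}^s b_i^{(0)} h_i(x) − 𝐢 ΔW Σ_{i=1}^s b_i^{(1)} h̃_i(x),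 then ∫ |φ^{n+1}(x)|² dx = ∫ |φⁿ(x)|² dx. -/
/-- The discrete quadratic identity behind conservation of quadratic invariants: for Runge–Kutta
coefficients with `b p * b q = b p * a p q + b q * a q p`, the change of the squared norm over a
step is a combination of inner products of the stages with the increments. -/
theorem norm_sq_symplectic_step {ι E : Type*} [Fintype ι] [NormedAddCommGroup E]
    [InnerProductSpace ℝ E] (a : ι → ι → ℝ) (b : ι → ℝ)
    (hab : ∀ p q, b p * b q = b p * a p q + b q * a q p)
    (u w : E) (v K : ι → E) (hv : ∀ p, v p = u + ∑ q, a p q • K q)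
    (hw : w = u + ∑ p, b p • K p) :
    ‖w‖ ^ 2 = ‖u‖ ^ 2 + 2 * ∑ p, b p * inner ℝ (v p) (K p) := by
  have hquad : ‖∑ p, b p • K p‖ ^ 2 = ∑ p, ∑ q, b p * b q * inner ℝ (K q) (K p) := by
    rw [← real_inner_self_eq_norm_sq, sum_inner]
    refine Finset.sum_congr rfl fun p _ => ?_
    rw [inner_sum]
    refine Finset.sum_congr rfl fun q _ => ?_
    rw [real_inner_smul_left, real_inner_smul_right, real_inner_comm]
    ring
  have hsym : ∑ p, ∑ q, b p * b q * inner ℝ (K q) (K p)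
      = 2 * ∑ p, ∑ q, b p * a p q * inner ℝ (K q) (K p) := by
    have hswap : ∑ p, ∑ q, b q * a q p * inner ℝ (K q) (K p)
        = ∑ p, ∑ q, b p * a p q * inner ℝ (K q) (K p) := by
      rw [Finset.sum_comm]
      simp only [real_inner_comm]
    simp only [hab, add_mul, Finset.sum_add_distrib]
    rw [hswap]
    ring
  have hstages : ∑ p, b p * inner ℝ (v p) (K p)
      = ∑ p, b p * inner ℝ u (K p) + ∑ p, ∑ q, b p * a p q * inner ℝ (K q) (K p) := by
    rw [← Finset.sum_add_distrib]
    refine Finset.sum_congr rfl fun p _ => ?_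
    rw [hv, inner_add_left, sum_inner, mul_add, Finset.mul_sum]
    simp only [real_inner_smul_left, mul_assoc]
  rw [hw, norm_add_sq_real, hquad, hsym, hstages, inner_sum]
  simp only [real_inner_smul_right]
  ring

theorem inner_I_mul_ofReal_mul_self (r : ℝ) (z : ℂ) : inner ℝ z (Complex.I * (r * z)) = 0 := by
  simp [Complex.inner]
  ring

theorem continuousOn_inner_I_mul_derivWithin_derivWithin {A B : ℝ} (hAB : A < B) {f : ℝ → ℂ}
    (hf : ContDiffOn ℝ 2 f (Set.Icc A B)) :
    ContinuousOn (fun x => inner ℝ (f x) (Complex.I *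
      derivWithin (derivWithin f (Set.Icc A B)) (Set.Icc A B) x)) (Set.Icc A B) := by
  have hu := uniqueDiffOn_Icc hAB
  have h1 : ContDiffOn ℝ 1 (derivWithin f (Set.Icc A B)) (Set.Icc A B) :=
    hf.derivWithin hu (by norm_num)
  exact hf.continuousOn.inner (𝕜 := ℝ)
    (continuousOn_const.mul (h1.continuousOn_derivWithin hu le_rfl))

/-- The Laplacian with Dirichlet boundary conditions is symmetric. -/
theorem integral_inner_I_mul_derivWithin_derivWithin {A B : ℝ} (hAB : A < B) {f : ℝ → ℂ}
    (hf : ContDiffOn ℝ 2 f (Set.Icc A B)) (hA : f A = 0) (hB : f B = 0) :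
    ∫ x in A..B, inner ℝ (f x) (Complex.I *
      derivWithin (derivWithin f (Set.Icc A B)) (Set.Icc A B) x) = 0 := by
  have hu := uniqueDiffOn_Icc hAB
  have h1 : ContDiffOn ℝ 1 (derivWithin f (Set.Icc A B)) (Set.Icc A B) :=
    hf.derivWithin hu (by norm_num)
  rw [intervalIntegral.integral_eq_sub_of_hasDerivAt_of_le hAB.le
    (f := fun x => inner ℝ (f x) (Complex.I * derivWithin f (Set.Icc A B) x))
    (hf.continuousOn.inner (𝕜 := ℝ) (continuousOn_const.mul h1.continuousOn))]
  · simp [hA, hB]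
  · intro x hx
    have hmem : Set.Icc A B ∈ nhds x := Icc_mem_nhds hx.1 hx.2
    have hxm : x ∈ Set.Icc A B := Set.Ioo_subset_Icc_self hx
    have d0 := ((hf.differentiableOn (by norm_num)) x hxm).hasDerivWithinAt.hasDerivAt hmem
    have d1 := ((h1.differentiableOn (by norm_num)) x hxm).hasDerivWithinAt.hasDerivAt hmem
    have hd := d0.inner ℝ (d1.const_mul Complex.I)
    have hz := inner_I_mul_ofReal_mul_self 1 (derivWithin f (Set.Icc A B) x)
    rw [Complex.ofReal_one, one_mul] at hz
    rwa [hz, add_zero] at hd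
  · exact ContinuousOn.intervalIntegrable (by
      rw [Set.uIcc_of_le hAB.le]
      exact continuousOn_inner_I_mul_derivWithin_derivWithin hAB hf)

/-- Discrete charge conservation for symplectic stochastic Runge–Kutta
semi-discretizations of the stochastic Schrödinger equation
(Proposition 3.3, conservation part, pathwise form). -/
theorem discrete_charge_conservation_symplectic_SRK
    (L : ℝ) (hL : 0 < L) (s : ℕ) (hs : 1 ≤ s)
    (a0 a1 : Fin s → Fin s → ℝ) (b0 b1 : Fin s → ℝ)
    (hsymp0 : ∀ i j, b0 i * b0 j = b0 i * a0 i j + b0 j * a0 j i)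
    (hsymp1 : ∀ i j, b0 i * b1 j = b0 i * a1 i j + b1 j * a0 j i)
    (hsymp2 : ∀ i j, b1 i * b1 j = b1 i * a1 i j + b1 j * a1 j i)
    (Δt ΔW ε : ℝ)
    (φn φn1 : ℝ → ℂ)
    (hφn : ContinuousOn φn (Set.Icc (-L) L))
    (hφn1 : ContinuousOn φn1 (Set.Icc (-L) L))
    (φ : Fin s → ℝ → ℂ)
    (hφ : ∀ i, ContDiffOn ℝ 2 (φ i) (Set.Icc (-L) L))
    (hbc : ∀ i, φ i (-L) = 0 ∧ φ i L = 0)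
    (Ψ' : Fin s → ℝ → ℝ)
    (hΨ' : ∀ i, ContinuousOn (Ψ' i) (Set.Icc (-L) L))
    (h htil : Fin s → ℝ → ℂ)
    (hh : ∀ i, ∀ x ∈ Set.Icc (-L) L,
      h i x = derivWithin (derivWithin (φ i) (Set.Icc (-L) L)) (Set.Icc (-L) L) x
        + (Ψ' i x : ℂ) * φ i x)
    (hhtil : ∀ i, ∀ x ∈ Set.Icc (-L) L, htil i x = (ε : ℂ) * φ i x)
    (hstage : ∀ x ∈ Set.Icc (-L) L, ∀ i,
      φ i x = φn x + Complex.I * (Δt : ℂ) * ∑ j, (a0 i j : ℂ) * h j x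
        - Complex.I * (ΔW : ℂ) * ∑ j, (a1 i j : ℂ) * htil j x)
    (hstep : ∀ x ∈ Set.Icc (-L) L,
      φn1 x = φn x + Complex.I * (Δt : ℂ) * ∑ i, (b0 i : ℂ) * h i x
        - Complex.I * (ΔW : ℂ) * ∑ i, (b1 i : ℂ) * htil i x) :
    ∫ x in (-L)..L, ‖φn1 x‖ ^ 2 = ∫ x in (-L)..L, ‖φn x‖ ^ 2 := by
  set S := Set.Icc (-L) L with hS
  have hlt : -L < L := by linarith
  let J : Fin s → ℝ → ℝ := fun i x =>
    inner ℝ (φ i x) (Complex.I * derivWithin (derivWithin (φ i) S) S x)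
  have hJint : ∀ i, IntervalIntegrable (J i) MeasureTheory.volume (-L) L := fun i =>
    ContinuousOn.intervalIntegrable (by
      rw [Set.uIcc_of_le hlt.le]
      exact continuousOn_inner_I_mul_derivWithin_derivWithin hlt (hφ i))
  have hJzero : ∀ i, ∫ x in (-L)..L, J i x = 0 := fun i =>
    integral_inner_I_mul_derivWithin_derivWithin hlt (hφ i) (hbc i).1 (hbc i).2
  have hpoint : ∀ x ∈ S, ‖φn1 x‖ ^ 2 = ‖φn x‖ ^ 2 + ∑ i, 2 * (b0 i * Δt) * J i x := by
    intro x hx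
    have key := norm_sq_symplectic_step (ι := Fin s ⊕ Fin s)
      (fun p => Sum.elim (a0 (p.elim id id)) (a1 (p.elim id id))) (Sum.elim b0 b1)
      (by
        rintro (i | i) (j | j)
        · exact hsymp0 i j
        · exact hsymp1 i j
        · have := hsymp1 j i
          simp only [Sum.elim_inl, Sum.elim_inr, id]
          linarith
        · exact hsymp2 i j)
      (φn x) (φn1 x) (fun p => φ (p.elim id id) x)
      (Sum.elim (fun i => Complex.I * (Δt * h i x)) (fun i => Complex.I * (-ΔW * htil i x)))
      (by
        intro p
        simp only [Fintype.sum_sum_type, Sum.elim_inl, Sum.elim_inr, Complex.real_smul]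
        rw [hstage x hx, Finset.mul_sum, Finset.mul_sum, add_sub_assoc, sub_eq_add_neg,
          ← Finset.sum_neg_distrib]
        congr 2 <;> exact Finset.sum_congr rfl fun j _ => by ring)
      (by
        simp only [Fintype.sum_sum_type, Sum.elim_inl, Sum.elim_inr, Complex.real_smul]
        rw [hstep x hx, Finset.mul_sum, Finset.mul_sum, add_sub_assoc, sub_eq_add_neg,
          ← Finset.sum_neg_distrib]
        congr 2 <;> exact Finset.sum_congr rfl fun j _ => by ring)
    have hdet : ∀ i, inner ℝ (φ i x) (Complex.I * (Δt * h i x)) = Δt * J i x := by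
      intro i
      have hsplit : Complex.I * (Δt * h i x)
          = Δt • (Complex.I * derivWithin (derivWithin (φ i) S) S x
            + Complex.I * ((Ψ' i x : ℂ) * φ i x)) := by
        rw [hh i x hx, Complex.real_smul]
        ring
      rw [hsplit, real_inner_smul_right, inner_add_right, inner_I_mul_ofReal_mul_self, add_zero]
    have hnoise : ∀ i, inner ℝ (φ i x) (Complex.I * (-ΔW * htil i x)) = 0 := by
      intro i
      rw [hhtil i x hx, ← inner_I_mul_ofReal_mul_self (-ΔW * ε) (φ i x)]
      push_cast
      ring_nf
    rw [key]
    simp only [Fintype.sum_sum_type, Sum.elim_inl, Sum.elim_inr, id, hdet, hnoise, mul_zero,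
      Finset.sum_const_zero, add_zero, Finset.mul_sum]
    congr 1
    exact Finset.sum_congr rfl fun i _ => by ring
  have hterm : ∀ i ∈ (Finset.univ : Finset (Fin s)),
      IntervalIntegrable (fun x => 2 * (b0 i * Δt) * J i x) MeasureTheory.volume (-L) L :=
    fun i _ => (hJint i).const_mul _
  have hφnint : IntervalIntegrable (fun x => ‖φn x‖ ^ 2) MeasureTheory.volume (-L) L :=
    ContinuousOn.intervalIntegrable (by
      rw [Set.uIcc_of_le hlt.le]
      exact hφn.norm.pow 2)
  have hsumint : IntervalIntegrable (fun x => ∑ i, 2 * (b0 i * Δt) * J i x)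
      MeasureTheory.volume (-L) L := by
    simpa only [Finset.sum_fn] using IntervalIntegrable.sum Finset.univ hterm
  rw [intervalIntegral.integral_congr
    (g := fun x => ‖φn x‖ ^ 2 + ∑ i, 2 * (b0 i * Δt) * J i x)
    (fun x hx => hpoint x (by rwa [Set.uIcc_of_le hlt.le] at hx)),
    intervalIntegral.integral_add hφnint hsumint,
    intervalIntegral.integral_finsetSum hterm]
  simp only [intervalIntegral.integral_const_mul, hJzero, mul_zero, Finset.sum_const_zero,
    add_zero]
end

section
/- Discrete charge conservation for the stochastic midpoint scheme (Corollary 3.4, pathwise form): Let Δt, ΔW, ε ∈ ℝ, let φⁿ, φ^{n+1} : [−L,L] → ℂ be such that φ^{n+1/2} := (φⁿ + φ^{n+1})/2 is twice continuously differentiable and satisfies Dirichlet boundary conditions, and let g : [−L,L] → ℝ be continuous (for example g(x) = Ψ'(|φ^{n+1/2}(x)|², x, t_{n+1/2}) for a real nonlinearity Ψ'). If for every x ∈ [−L,L] one has φ^{n+1}(x) = φⁿ(x) + 𝐢 Δt (φ^{n+1/2})''(x) + 𝐢 Δt g(x) φ^{n+1/2}(x) − 𝐢 ε ΔW φ^{n+1/2}(x),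 then ∫ |φ^{n+1}(x)|² dx = ∫ |φⁿ(x)|² dx. -/
open Set ComplexConjugate in
/-- The imaginary part of `conj f` times the second derivative of `f` integrates to zero,
for a twice continuously
differentiable `f` with Dirichlet boundary conditions. -/
theorem integral_im_conj_mul_derivWithin_derivWithin_eq_zero {a b : ℝ} (hab : a < b) {f : ℝ → ℂ}
    (hf : ContDiffOn ℝ 2 f (Icc a b)) (ha : f a = 0) (hb : f b = 0) :
    ∫ x in a..b, (conj (f x) * derivWithin (derivWithin f (Icc a b)) (Icc a b) x).im = 0 := by
  have hu : UniqueDiffOn ℝ (Icc a b) := uniqueDiffOn_Icc hab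
  have hf1 : ContDiffOn ℝ 1 (derivWithin f (Icc a b)) (Icc a b) :=
    hf.derivWithin hu (by norm_num)
  have hf2 : ContinuousOn (derivWithin (derivWithin f (Icc a b)) (Icc a b)) (Icc a b) :=
    hf1.continuousOn_derivWithin hu le_rfl
  have hc := hf.continuousOn
  have hc1 := hf1.continuousOn
  have hconj : ContinuousOn (fun x => conj (f x)) (Icc a b) :=
    Complex.continuous_conj.comp_continuousOn hc
  rw [intervalIntegral.integral_eq_sub_of_hasDerivAt_of_le
    (f := fun x => (conj (f x) * derivWithin f (Icc a b) x).im) hab.le]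
  · simp [ha, hb]
  · exact Complex.continuous_im.comp_continuousOn (hconj.mul hc1)
  · intro x hx
    have hn : Icc a b ∈ nhds x := Icc_mem_nhds hx.1 hx.2
    have hxI := Ioo_subset_Icc_self hx
    have h1 : HasDerivAt f (derivWithin f (Icc a b) x) x :=
      ((hf.differentiableOn (by norm_num)) x hxI).hasDerivWithinAt.hasDerivAt hn
    have h2 := ((hf1.differentiableOn (by norm_num)) x hxI).hasDerivWithinAt.hasDerivAt hn
    have h3 : HasDerivAt (fun y => conj (f y)) (conj (derivWithin f (Icc a b) x)) x :=
      Complex.conjCLE.toContinuousLinearMap.hasFDerivAt.comp_hasDerivAt x h1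
    refine (Complex.imCLM.hasFDerivAt.comp_hasDerivAt x (h3.mul h2)).congr_deriv ?_
    simp only [Complex.imCLM_apply, Complex.add_im, Complex.mul_im, Complex.conj_re,
      Complex.conj_im]
    ring
  · refine ContinuousOn.intervalIntegrable ?_
    rw [uIcc_of_le hab.le]
    exact Complex.continuous_im.comp_continuousOn (hconj.mul hf2)


/-- Discrete charge conservation for the stochastic midpoint scheme
(Corollary 3.4, pathwise form). -/
theorem discrete_charge_conservation_midpoint
    (L : ℝ) (hL : 0 < L) (Δt ΔW ε : ℝ)
    (φn φn1 : ℝ → ℂ) (mid : ℝ → ℂ)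
    (hmid : ∀ x, mid x = (φn x + φn1 x) / 2)
    (hreg : ContDiffOn ℝ 2 mid (Set.Icc (-L) L))
    (hbc1 : mid (-L) = 0) (hbc2 : mid L = 0)
    (g : ℝ → ℝ) (hg : ContinuousOn g (Set.Icc (-L) L))
    (hscheme : ∀ x ∈ Set.Icc (-L) L,
      φn1 x = φn x
        + Complex.I * (Δt : ℂ)
            * derivWithin (derivWithin mid (Set.Icc (-L) L)) (Set.Icc (-L) L) x
        + Complex.I * (Δt : ℂ) * (g x : ℂ) * mid x
        - Complex.I * (ε : ℂ) * (ΔW : ℂ) * mid x) :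
    ∫ x in (-L)..L, ‖φn1 x‖ ^ 2 = ∫ x in (-L)..L, ‖φn x‖ ^ 2 := by
  set I := Set.Icc (-L) L
  have hlt : -L < L := by linarith
  have hu : UniqueDiffOn ℝ I := uniqueDiffOn_Icc hlt
  have hc := hreg.continuousOn
  have hc2 : ContinuousOn (derivWithin (derivWithin mid I) I) I :=
    (hreg.derivWithin hu (m := 1) (by norm_num)).continuousOn_derivWithin hu le_rfl
  have hgc : ContinuousOn (fun x => (g x : ℂ)) I := Complex.continuous_ofReal.comp_continuousOn hg
  let d : ℝ → ℂ := fun x => Complex.I * (Δt : ℂ) * derivWithin (derivWithin mid I) I x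
    + Complex.I * (Δt : ℂ) * (g x : ℂ) * mid x - Complex.I * (ε : ℂ) * (ΔW : ℂ) * mid x
  have hd : ContinuousOn d I :=
    ((continuousOn_const.mul hc2).add ((continuousOn_const.mul hgc).mul hc)).sub
      (continuousOn_const.mul hc)
  have hn1 : ∀ x ∈ I, φn1 x = mid x + d x / 2 := fun x hx => by
    linear_combination hscheme x hx / 2 - hmid x
  have hn : ∀ x ∈ I, φn x = mid x - d x / 2 := fun x hx => by
    linear_combination -hscheme x hx / 2 - hmid x
  have hint : ∀ φ : ℝ → ℂ, ContinuousOn φ I →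
      IntervalIntegrable (fun x => ‖φ x‖ ^ 2) MeasureTheory.volume (-L) L := fun φ hφ => by
    refine ContinuousOn.intervalIntegrable ?_
    rw [Set.uIcc_of_le hlt.le]
    exact hφ.norm.pow 2
  rw [← sub_eq_zero, ← intervalIntegral.integral_sub
    (hint φn1 ((hc.add (hd.div_const 2)).congr hn1)) (hint φn ((hc.sub (hd.div_const 2)).congr hn))]
  calc
    _ = ∫ x in (-L)..L, (-2 * Δt) *
          ((starRingEnd ℂ) (mid x) * derivWithin (derivWithin mid I) I x).im := by
      refine intervalIntegral.integral_congr fun x hx => ?_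
      rw [Set.uIcc_of_le hlt.le] at hx
      simp only [hn1 x hx, hn x hx, Complex.sq_norm, Complex.normSq_apply, d]
      simp
      ring
    _ = 0 := by
      rw [intervalIntegral.integral_const_mul,
        integral_im_conj_mul_derivWithin_derivWithin_eq_zero hlt hreg hbc1 hbc2, mul_zero]
end

section
/- Pathwise discrete energy identity for the stochastic midpoint scheme (Proposition 3.6, corrected form): Let Δt, ε ∈ ℝ with Δt ≠ 0, let g, w : [−L,L] → ℝ be continuous, and let φⁿ, φ^{n+1} : [−L,L] → ℂ be twice continuously differentiable functions satisfying Dirichlet boundary conditions; set φ^{n+1/2} := (φⁿ + φ^{n+1})/2. If for every x ∈ [−L,L] one has φ^{n+1}(x) = φⁿ(x) + 𝐢 Δt (φ^{n+1/2})''(x) + 𝐢 Δt g(x) φ^{n+1/2}(x) − 𝐢 ε w(x) φ^{n+1/2}(x), then ∫ |(φ^{n+1})'(x)|² dx − ∫ |(φⁿ)'(x)|² dx − ∫ g(x) (|φ^{n+1}(x)|² − |φⁿ(x)|²) dx = − (ε/Δt) ∫ w(x) (|φ^{n+1}(x)|² − |φⁿ(x)|²) dx. -/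
/-- Pointwise energy balance of the midpoint scheme: `a`, `b` are the old and new values, `da`, `db`
their derivatives, and `m` the second derivative of the midpoint. -/
theorem midpoint_energy_density {τ ε g w : ℝ} (hτ : τ ≠ 0) {a b da db m : ℂ}
    (h : b = a + Complex.I * (τ : ℂ) * m + Complex.I * (τ : ℂ) * (g : ℂ) * ((a + b) / 2)
      - Complex.I * (ε : ℂ) * (w : ℂ) * ((a + b) / 2)) :
    2 * (inner ℝ ((da + db) / 2) (db - da) + inner ℝ m (b - a))
      = ‖db‖ ^ 2 - ‖da‖ ^ 2 - g * (‖b‖ ^ 2 - ‖a‖ ^ 2) + ε / τ * (w * (‖b‖ ^ 2 - ‖a‖ ^ 2)) := by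
  have hre := congrArg Complex.re h
  have him := congrArg Complex.im h
  simp only [Complex.add_re, Complex.sub_re, Complex.mul_re, Complex.I_re, Complex.I_im,
    Complex.ofReal_re, Complex.ofReal_im, Complex.add_im, Complex.sub_im, Complex.mul_im,
    Complex.div_ofNat_re, Complex.div_ofNat_im] at hre him
  simp only [Complex.inner, Complex.sq_norm, Complex.normSq_apply, Complex.mul_re, Complex.conj_re,
    Complex.conj_im, Complex.add_re, Complex.sub_re, Complex.add_im, Complex.sub_im,
    Complex.div_ofNat_re, Complex.div_ofNat_im]
  field_simp
  linear_combination 2 * (b.im - a.im) * hre - 2 * (b.re - a.re) * him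

/-- Pathwise discrete energy identity for the stochastic midpoint scheme
(Proposition 3.6, corrected form). -/
theorem pathwise_discrete_energy_identity_midpoint
    (L : ℝ) (hL : 0 < L) (Δt : ℝ) (hΔt : Δt ≠ 0) (ε : ℝ)
    (g w : ℝ → ℝ)
    (hg : ContinuousOn g (Set.Icc (-L) L))
    (hw : ContinuousOn w (Set.Icc (-L) L))
    (φn φn1 : ℝ → ℂ)
    (hφn : ContDiffOn ℝ 2 φn (Set.Icc (-L) L))
    (hφn1 : ContDiffOn ℝ 2 φn1 (Set.Icc (-L) L))
    (hbcn1 : φn (-L) = 0) (hbcn2 : φn L = 0)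
    (hbcn11 : φn1 (-L) = 0) (hbcn12 : φn1 L = 0)
    (hscheme : ∀ x ∈ Set.Icc (-L) L,
      φn1 x = φn x
        + Complex.I * (Δt : ℂ)
            * derivWithin (derivWithin (fun y => (φn y + φn1 y) / 2) (Set.Icc (-L) L))
                (Set.Icc (-L) L) x
        + Complex.I * (Δt : ℂ) * (g x : ℂ) * ((φn x + φn1 x) / 2)
        - Complex.I * (ε : ℂ) * (w x : ℂ) * ((φn x + φn1 x) / 2)) :
    (∫ x in (-L)..L, ‖derivWithin φn1 (Set.Icc (-L) L) x‖ ^ 2)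
      - (∫ x in (-L)..L, ‖derivWithin φn (Set.Icc (-L) L) x‖ ^ 2)
      - (∫ x in (-L)..L, g x * (‖φn1 x‖ ^ 2 - ‖φn x‖ ^ 2))
    = -(ε / Δt) * ∫ x in (-L)..L, w x * (‖φn1 x‖ ^ 2 - ‖φn x‖ ^ 2) := by
  have hLL : -L < L := by linarith
  set I := Set.Icc (-L) L
  have hu : UniqueDiffOn ℝ I := uniqueDiffOn_Icc hLL
  have hm : ContDiffOn ℝ 2 (fun y => (φn y + φn1 y) / 2) I := (hφn.add hφn1).div_const 2
  have hDm : ContDiffOn ℝ 1 (derivWithin (fun y => (φn y + φn1 y) / 2) I) I :=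
    hm.derivWithin hu (by norm_num)
  have hDa : ContinuousOn (derivWithin φn I) I := hφn.continuousOn_derivWithin hu (by norm_num)
  have hDb : ContinuousOn (derivWithin φn1 I) I := hφn1.continuousOn_derivWithin hu (by norm_num)
  have ha := hφn.continuousOn
  have hb := hφn1.continuousOn
  have hInt {f : ℝ → ℝ} (hf : ContinuousOn f I) : IntervalIntegrable f MeasureTheory.volume (-L) L :=
    ContinuousOn.intervalIntegrable_of_Icc hLL.le hf
  have cb : ContinuousOn (fun x => ‖derivWithin φn1 I x‖ ^ 2) I := hDb.norm.pow 2
  have ca : ContinuousOn (fun x => ‖derivWithin φn I x‖ ^ 2) I := hDa.norm.pow 2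
  have cg : ContinuousOn (fun x => g x * (‖φn1 x‖ ^ 2 - ‖φn x‖ ^ 2)) I :=
    hg.mul ((hb.norm.pow 2).sub (ha.norm.pow 2))
  have cw : ContinuousOn (fun x => ε / Δt * (w x * (‖φn1 x‖ ^ 2 - ‖φn x‖ ^ 2))) I :=
    continuousOn_const.mul (hw.mul ((hb.norm.pow 2).sub (ha.norm.pow 2)))
  have cab : ContinuousOn (fun x => ‖derivWithin φn1 I x‖ ^ 2 - ‖derivWithin φn I x‖ ^ 2) I :=
    cb.sub ca
  have cabg : ContinuousOn (fun x => ‖derivWithin φn1 I x‖ ^ 2 - ‖derivWithin φn I x‖ ^ 2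
      - g x * (‖φn1 x‖ ^ 2 - ‖φn x‖ ^ 2)) I := cab.sub cg
  have cabgw : ContinuousOn (fun x => ‖derivWithin φn1 I x‖ ^ 2 - ‖derivWithin φn I x‖ ^ 2
      - g x * (‖φn1 x‖ ^ 2 - ‖φn x‖ ^ 2)
      + ε / Δt * (w x * (‖φn1 x‖ ^ 2 - ‖φn x‖ ^ 2))) I := cabg.add cw
  have key : ∫ x in (-L)..L, (‖derivWithin φn1 I x‖ ^ 2 - ‖derivWithin φn I x‖ ^ 2
      - g x * (‖φn1 x‖ ^ 2 - ‖φn x‖ ^ 2) + ε / Δt * (w x * (‖φn1 x‖ ^ 2 - ‖φn x‖ ^ 2))) = 0 := by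
    rw [intervalIntegral.integral_eq_sub_of_hasDerivAt_of_le hLL.le
      (f := fun x => 2 * inner ℝ (derivWithin (fun y => (φn y + φn1 y) / 2) I x) (φn1 x - φn x))
      _ _ (hInt cabgw)]
    · simp [hbcn1, hbcn2, hbcn11, hbcn12]
    · exact continuousOn_const.mul (hDm.continuousOn.inner (𝕜 := ℝ) (hb.sub ha))
    · intro x hx
      have hxI : x ∈ I := Set.Ioo_subset_Icc_self hx
      have hnhds : I ∈ nhds x := Icc_mem_nhds hx.1 hx.2
      have hda := (hφn.differentiableOn (by norm_num) x hxI).hasDerivWithinAt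
      have hdb := (hφn1.differentiableOn (by norm_num) x hxI).hasDerivWithinAt
      have hdm := (hDm.differentiableOn (by norm_num) x hxI).hasDerivWithinAt
      have hmid : derivWithin (fun y => (φn y + φn1 y) / 2) I x
          = (derivWithin φn I x + derivWithin φn1 I x) / 2 :=
        ((hda.add hdb).div_const 2).derivWithin (hu x hxI)
      have hF := (((hdm.hasDerivAt hnhds).inner ℝ
        ((hdb.hasDerivAt hnhds).sub (hda.hasDerivAt hnhds))).const_mul (2 : ℝ))
      refine hF.congr_deriv ?_
      simp only [Pi.sub_apply]
      rw [hmid]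
      exact midpoint_energy_density hΔt (hscheme x hxI)
  rw [intervalIntegral.integral_add (hInt cabg) (hInt cw),
    intervalIntegral.integral_sub (hInt cab) (hInt cg),
    intervalIntegral.integral_sub (hInt cb) (hInt ca),
    intervalIntegral.integral_const_mul] at key
  linarith
end

section
/- Coercivity inequality for the midpoint map (step in the existence proof of Proposition 3.3): Let Δt, ΔW, ε ∈ ℝ, let φⁿ : [−L,L] → ℂ be continuous, and let m : [−L,L] → ℝ be continuous. For u : [−L,L] → ℂ twice continuously differentiable with Dirichlet boundary conditions, define Π(u)(x) := u(x) − φⁿ(x) − (𝐢 Δt/2)(u''(x) + m(x) u(x)) + (𝐢 ε/2) ΔW · u(x). Then Re ∫ Π(u)(x) · conj(u(x)) dx ≥ ‖u‖ (‖u‖ − ‖φⁿ‖), where ‖v‖² = ∫ |v(x)|² dx. In particular, if ‖u‖ = ‖φⁿ‖ + 1 then Re ∫ Π(u) conj(u) dx > 0. -/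
open MeasureTheory in
/-- Cauchy-Schwarz inequality for the interval integral of continuous functions. -/
theorem intervalIntegral_mul_le_sqrt_mul_sqrt {a b : ℝ} (hab : a ≤ b) {f g : ℝ → ℝ}
    (hf : ContinuousOn f (Set.Icc a b)) (hg : ContinuousOn g (Set.Icc a b)) :
    ∫ x in a..b, f x * g x
      ≤ Real.sqrt (∫ x in a..b, f x ^ 2) * Real.sqrt (∫ x in a..b, g x ^ 2) := by
  have hint : ∀ {k : ℝ → ℝ}, ContinuousOn k (Set.Icc a b) → IntervalIntegrable k volume a b :=
    fun hk => hk.intervalIntegrable_of_Icc hab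
  have hquad : ∀ t : ℝ, 0 ≤ (∫ x in a..b, g x ^ 2) * (t * t)
      + (-2 * ∫ x in a..b, f x * g x) * t + ∫ x in a..b, f x ^ 2 := by
    intro t
    have h0 : 0 ≤ ∫ x in a..b, (f x - t * g x) ^ 2 :=
      intervalIntegral.integral_nonneg hab fun x _ => sq_nonneg _
    have hexp : ∫ x in a..b, (f x - t * g x) ^ 2
        = ∫ x in a..b, (t * t) * g x ^ 2 + (-2 * t) * (f x * g x) + f x ^ 2 := by
      congr 1 with x
      ring
    rw [hexp, intervalIntegral.integral_add (hint (by fun_prop)) (hint (by fun_prop)),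
      intervalIntegral.integral_add (hint (by fun_prop)) (hint (by fun_prop)),
      intervalIntegral.integral_const_mul, intervalIntegral.integral_const_mul] at h0
    linarith
  have hdiscr := discrim_le_zero hquad
  rw [discrim] at hdiscr
  rw [← Real.sqrt_mul (intervalIntegral.integral_nonneg hab fun x _ => sq_nonneg _)]
  refine Real.le_sqrt_of_sq_le ?_
  linarith

/-- The Dirichlet Laplacian on an interval is symmetric: `∫ u'' conj u` is real. -/
theorem integral_im_derivWithin_derivWithin_mul_conj_eq_zero {a b : ℝ} (hab : a < b)
    {u : ℝ → ℂ} (hu : ContDiffOn ℝ 2 u (Set.Icc a b)) (ha : u a = 0) (hb : u b = 0) :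
    ∫ x in a..b, (derivWithin (derivWithin u (Set.Icc a b)) (Set.Icc a b) x
      * (starRingEnd ℂ) (u x)).im = 0 := by
  have hs : UniqueDiffOn ℝ (Set.Icc a b) := uniqueDiffOn_Icc hab
  have hv : ContDiffOn ℝ 1 (derivWithin u (Set.Icc a b)) (Set.Icc a b) :=
    hu.derivWithin hs (by norm_num)
  have hw : ContinuousOn (derivWithin (derivWithin u (Set.Icc a b)) (Set.Icc a b))
      (Set.Icc a b) := hv.continuousOn_derivWithin hs le_rfl
  have hderiv : ∀ {f : ℝ → ℂ}, DifferentiableOn ℝ f (Set.Icc a b) → ∀ x ∈ Set.Ioo a b,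
      HasDerivAt f (derivWithin f (Set.Icc a b) x) x := fun hf x hx =>
    (hf x (Set.Ioo_subset_Icc_self hx)).hasDerivWithinAt.hasDerivAt (Icc_mem_nhds hx.1 hx.2)
  have huc := hu.continuousOn
  have hvc := hv.continuousOn
  have key := intervalIntegral.integral_eq_sub_of_hasDerivAt_of_le hab.le
    (f := fun x => (derivWithin u (Set.Icc a b) x * (starRingEnd ℂ) (u x)).im)
    (f' := fun x => (derivWithin (derivWithin u (Set.Icc a b)) (Set.Icc a b) x
      * (starRingEnd ℂ) (u x)).im)
    (Complex.continuous_im.comp_continuousOn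
      (hvc.mul (Complex.continuous_conj.comp_continuousOn huc)))
    (fun x hx => by
      have h := (hderiv (hv.differentiableOn one_ne_zero) x hx).mul
        (hderiv (hu.differentiableOn two_ne_zero) x hx).star
      refine (Complex.imCLM.hasFDerivAt.comp_hasDerivAt x h).congr_deriv ?_
      simp
      ring)
    (ContinuousOn.intervalIntegrable_of_Icc hab.le (Complex.continuous_im.comp_continuousOn
      (hw.mul (Complex.continuous_conj.comp_continuousOn huc))))
  rw [key]
  simp [ha, hb]


/-- Coercivity inequality for the midpoint map (step in the existence proof of
Proposition 3.3): `Re ∫ Π(u) conj u ≥ ‖u‖(‖u‖ - ‖φⁿ‖)` with the `L²` norms on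
`[-L, L]`; in particular `Re ∫ Π(u) conj u > 0` on the sphere `‖u‖ = ‖φⁿ‖ + 1`. -/
theorem coercivity_midpoint_map
    (L : ℝ) (hL : 0 < L) (Δt ΔW ε : ℝ)
    (φn : ℝ → ℂ) (hφn : ContinuousOn φn (Set.Icc (-L) L))
    (m : ℝ → ℝ) (hm : ContinuousOn m (Set.Icc (-L) L))
    (u : ℝ → ℂ) (hu : ContDiffOn ℝ 2 u (Set.Icc (-L) L))
    (hbc1 : u (-L) = 0) (hbc2 : u L = 0)
    (Pu : ℝ → ℂ)
    (hPu : ∀ x ∈ Set.Icc (-L) L,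
      Pu x = u x - φn x
        - (Complex.I * (Δt : ℂ) / 2)
            * (derivWithin (derivWithin u (Set.Icc (-L) L)) (Set.Icc (-L) L) x
                + (m x : ℂ) * u x)
        + (Complex.I * (ε : ℂ) / 2) * (ΔW : ℂ) * u x) :
    Real.sqrt (∫ x in (-L)..L, ‖u x‖ ^ 2)
        * (Real.sqrt (∫ x in (-L)..L, ‖u x‖ ^ 2)
            - Real.sqrt (∫ x in (-L)..L, ‖φn x‖ ^ 2))
      ≤ (∫ x in (-L)..L, Pu x * (starRingEnd ℂ) (u x)).re
    ∧ (Real.sqrt (∫ x in (-L)..L, ‖u x‖ ^ 2)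
          = Real.sqrt (∫ x in (-L)..L, ‖φn x‖ ^ 2) + 1 →
        0 < (∫ x in (-L)..L, Pu x * (starRingEnd ℂ) (u x)).re) := by
  have hLL : -L < L := by linarith
  have hs : UniqueDiffOn ℝ (Set.Icc (-L) L) := uniqueDiffOn_Icc hLL
  have hw : ContinuousOn (derivWithin (derivWithin u (Set.Icc (-L) L)) (Set.Icc (-L) L))
      (Set.Icc (-L) L) :=
    (hu.derivWithin (m := 1) hs (by norm_num)).continuousOn_derivWithin hs le_rfl
  have hsymm := integral_im_derivWithin_derivWithin_mul_conj_eq_zero hLL hu hbc1 hbc2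
  set w := derivWithin (derivWithin u (Set.Icc (-L) L)) (Set.Icc (-L) L)
  have huc := hu.continuousOn
  have huconj : ContinuousOn (fun x => (starRingEnd ℂ) (u x)) (Set.Icc (-L) L) :=
    Complex.continuous_conj.comp_continuousOn huc
  have hmc : ContinuousOn (fun x => (m x : ℂ)) (Set.Icc (-L) L) :=
    Complex.continuous_ofReal.comp_continuousOn hm
  have hPc : ContinuousOn Pu (Set.Icc (-L) L) := ContinuousOn.congr (by fun_prop) hPu
  have hint : ∀ {k : ℝ → ℝ}, ContinuousOn k (Set.Icc (-L) L) →
      IntervalIntegrable k MeasureTheory.volume (-L) L :=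
    fun hk => hk.intervalIntegrable_of_Icc hLL.le
  have hre : (∫ x in (-L)..L, Pu x * (starRingEnd ℂ) (u x)).re
      = ∫ x in (-L)..L, (Pu x * (starRingEnd ℂ) (u x)).re :=
    (Complex.reCLM.intervalIntegral_comp_comm
      ((hPc.mul huconj).intervalIntegrable_of_Icc hLL.le)).symm
  have hpt : ∫ x in (-L)..L, (Pu x * (starRingEnd ℂ) (u x)).re
      = ∫ x in (-L)..L, (‖u x‖ ^ 2 - (φn x * (starRingEnd ℂ) (u x)).re
        + Δt / 2 * (w x * (starRingEnd ℂ) (u x)).im) := by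
    refine intervalIntegral.integral_congr fun x hx => ?_
    rw [Set.uIcc_of_le hLL.le] at hx
    simp only [hPu x hx, Complex.sq_norm, Complex.normSq_apply]
    simp
    ring
  have hφu : ContinuousOn (fun x => (φn x * (starRingEnd ℂ) (u x)).re) (Set.Icc (-L) L) :=
    Complex.continuous_re.comp_continuousOn (hφn.mul huconj)
  have hwu : ContinuousOn (fun x => (w x * (starRingEnd ℂ) (u x)).im) (Set.Icc (-L) L) :=
    Complex.continuous_im.comp_continuousOn (hw.mul huconj)
  rw [intervalIntegral.integral_add (hint (by fun_prop)) (hint (by fun_prop)),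
    intervalIntegral.integral_sub (hint (by fun_prop)) (hint hφu),
    intervalIntegral.integral_const_mul, hsymm, mul_zero, add_zero] at hpt
  have hcs : ∫ x in (-L)..L, (φn x * (starRingEnd ℂ) (u x)).re
      ≤ Real.sqrt (∫ x in (-L)..L, ‖φn x‖ ^ 2) * Real.sqrt (∫ x in (-L)..L, ‖u x‖ ^ 2) := by
    refine le_trans (intervalIntegral.integral_mono_on hLL.le (hint hφu)
      (hint (hφn.norm.mul huc.norm)) fun x _ => ?_)
      (intervalIntegral_mul_le_sqrt_mul_sqrt hLL.le hφn.norm huc.norm)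
    simpa using Complex.re_le_norm (φn x * (starRingEnd ℂ) (u x))
  have hsq : Real.sqrt (∫ x in (-L)..L, ‖u x‖ ^ 2) * Real.sqrt (∫ x in (-L)..L, ‖u x‖ ^ 2)
      = ∫ x in (-L)..L, ‖u x‖ ^ 2 :=
    Real.mul_self_sqrt (intervalIntegral.integral_nonneg hLL.le fun x _ => sq_nonneg _)
  have hmain : Real.sqrt (∫ x in (-L)..L, ‖u x‖ ^ 2)
        * (Real.sqrt (∫ x in (-L)..L, ‖u x‖ ^ 2) - Real.sqrt (∫ x in (-L)..L, ‖φn x‖ ^ 2))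
      ≤ (∫ x in (-L)..L, Pu x * (starRingEnd ℂ) (u x)).re := by
    rw [hre, hpt, mul_sub, hsq]
    linarith
  refine ⟨hmain, fun h => lt_of_lt_of_le ?_ hmain⟩
  rw [h, add_sub_cancel_left, mul_one]
  positivity
end
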